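/- (Closed form of the regularized pairwise aggregation recursion.) Let K ≥ 1, let X₁,…,X_K be real matrices with d columns (X_i of size n_i×d), Y₁,…,Y_K real matrices with C columns (Y_i of size n_i×C), and γ > 0. Set C_iʳ := X_iᵀX_i + γ·I and C_agg,kʳ := Σ_{i=1}^{k} C_iʳ. Define the recursion: Ŵ_agg,1ʳ := (C₁ʳ)⁻¹·X₁ᵀ·Y₁, and for 2 ≤ k ≤ K, Ŵ_agg,kʳ := 𝒲_agg·Ŵ_agg,k−1ʳ + 𝒲_k·Ŵ_kʳ, where Ŵ_kʳ := (C_kʳ)⁻¹·X_kᵀ·Y_k, 𝒲_agg := I − (C_agg,k−1ʳ)⁻¹·C_kʳ·(I − (C_agg,kʳ)⁻¹·C_kʳ) and 𝒲_k := I − (C_kʳ)⁻¹·C_agg,k−1ʳ·(I − (C_agg,kʳ)⁻¹·C_agg,k−1ʳ). Then for every 1 ≤ k ≤ K, all the matrices C_iʳ and C_agg,kʳ are invertible and Ŵ_agg,kʳ = (Σ_{i=1}^{k} C_iʳ)⁻¹·(Σ_{i=1}^{k} X_iᵀ·Y_i). -/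

import Mathlib

open Matrix

/-- The parallel-sum identity `B S⁻¹ A = A S⁻¹ B` with `S = A + B`, written as the collapse of an
aggregation weight. -/
lemma Matrix.one_sub_inv_mul_mul_one_sub_inv_mul {m R : Type*} [Fintype m] [DecidableEq m]
    [CommRing R] {A B : Matrix m m R} (hA : IsUnit A) (hS : IsUnit (A + B)) :
    1 - A⁻¹ * B * (1 - (A + B)⁻¹ * B) = (A + B)⁻¹ * A := by
  have hA' : A⁻¹ * A = 1 := nonsing_inv_mul A ((isUnit_iff_isUnit_det A).1 hA)
  have hdet := (isUnit_iff_isUnit_det _).1 hS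
  have hl : (A + B)⁻¹ * (A + B) = 1 := nonsing_inv_mul _ hdet
  have hr : (A + B) * (A + B)⁻¹ = 1 := mul_nonsing_inv _ hdet
  generalize (A + B)⁻¹ = T at hl hr ⊢
  have hTA : T * A = 1 - T * B := by rw [← hl]; noncomm_ring
  have hBT : B * T = 1 - A * T := by rw [← hr]; noncomm_ring
  calc 1 - A⁻¹ * B * (1 - T * B) = 1 - A⁻¹ * (B * T * A) := by rw [← hTA]; noncomm_ring
    _ = 1 - A⁻¹ * A * (1 - T * A) := by rw [hBT]; noncomm_ring
    _ = T * A := by rw [hA']; noncomm_ring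

/-- A regularized Gram matrix is positive definite. -/
lemma Matrix.posDef_transpose_mul_self_add_smul_one {m p : Type*} [Fintype m] [Fintype p]
    [DecidableEq p] (X : Matrix m p ℝ) {γ : ℝ} (hγ : 0 < γ) :
    (Xᵀ * X + γ • (1 : Matrix p p ℝ)).PosDef := by
  have h : (Xᵀ * X).PosSemidef := by
    simpa only [conjTranspose_eq_transpose_of_trivial] using posSemidef_conjTranspose_mul_self X
  exact PosDef.posSemidef_add h (PosDef.one.smul hγ)

/-- Closed form of the regularized pairwise aggregation recursion: the
accumulated aggregation weight after `k` clients equals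
`(Σᵢ Cᵢʳ)⁻¹ · (Σᵢ Xᵢᵀ·Yᵢ)`, and all the involved regularized matrices are
invertible. Clients are indexed `1, …, K`. -/
theorem regularized_aggregation_closed_form {d C K : ℕ} (hK : 1 ≤ K) {n : ℕ → ℕ}
    (X : ∀ i : ℕ, Matrix (Fin (n i)) (Fin d) ℝ)
    (Y : ∀ i : ℕ, Matrix (Fin (n i)) (Fin C) ℝ)
    (γ : ℝ) (hγ : 0 < γ)
    (W : ℕ → Matrix (Fin d) (Fin C) ℝ)
    (hW1 : W 1 = ((X 1)ᵀ * X 1 + γ • 1)⁻¹ * (X 1)ᵀ * Y 1)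
    (hWstep : ∀ k : ℕ, 2 ≤ k → k ≤ K →
      W k =
        (1 - (∑ i ∈ Finset.Icc 1 (k - 1), ((X i)ᵀ * X i + γ • 1))⁻¹ *
              ((X k)ᵀ * X k + γ • 1) *
              (1 - (∑ i ∈ Finset.Icc 1 k, ((X i)ᵀ * X i + γ • 1))⁻¹ *
                ((X k)ᵀ * X k + γ • 1))) * W (k - 1)
        + (1 - ((X k)ᵀ * X k + γ • 1)⁻¹ *
              (∑ i ∈ Finset.Icc 1 (k - 1), ((X i)ᵀ * X i + γ • 1)) *
              (1 - (∑ i ∈ Finset.Icc 1 k, ((X i)ᵀ * X i + γ • 1))⁻¹ *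
                (∑ i ∈ Finset.Icc 1 (k - 1), ((X i)ᵀ * X i + γ • 1)))) *
            (((X k)ᵀ * X k + γ • 1)⁻¹ * (X k)ᵀ * Y k)) :
    ∀ k : ℕ, 1 ≤ k → k ≤ K →
      (∀ i : ℕ, IsUnit ((X i)ᵀ * X i + γ • (1 : Matrix (Fin d) (Fin d) ℝ))) ∧
      IsUnit (∑ i ∈ Finset.Icc 1 k, ((X i)ᵀ * X i + γ • (1 : Matrix (Fin d) (Fin d) ℝ))) ∧
      W k = (∑ i ∈ Finset.Icc 1 k, ((X i)ᵀ * X i + γ • 1))⁻¹ *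
              (∑ i ∈ Finset.Icc 1 k, (X i)ᵀ * Y i) := by
  have hpos : ∀ i : ℕ, ((X i)ᵀ * X i + γ • (1 : Matrix (Fin d) (Fin d) ℝ)).PosDef :=
    fun i => posDef_transpose_mul_self_add_smul_one (X i) hγ
  generalize hG : (fun i : ℕ => (X i)ᵀ * X i + γ • (1 : Matrix (Fin d) (Fin d) ℝ)) = G at *
  have hGi : ∀ i, (X i)ᵀ * X i + γ • (1 : Matrix (Fin d) (Fin d) ℝ) = G i := congrFun hG
  simp only [hGi] at *
  have hu : ∀ i, IsUnit (G i) := fun i => (hpos i).isUnit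
  have hsum : ∀ k, 1 ≤ k → IsUnit (∑ i ∈ Finset.Icc 1 k, G i) := fun k hk =>
    (posDef_sum (Finset.nonempty_Icc.2 hk) fun i _ => hpos i).isUnit
  intro k hk hkK
  refine ⟨hu, hsum k hk, ?_⟩
  induction k, hk using Nat.le_induction with
  | base => simp [hW1, Matrix.mul_assoc]
  | succ k hk ih =>
    have hS := hsum (k + 1) (by omega)
    rw [hWstep (k + 1) (by omega) hkK, Nat.add_sub_cancel, ih (by omega)]
    rw [Finset.sum_Icc_succ_top (by omega)] at hS ⊢
    rw [Finset.sum_Icc_succ_top (by omega)]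
    have hA := hsum k hk
    have hB := hu (k + 1)
    generalize ∑ i ∈ Finset.Icc 1 k, G i = A at *
    generalize G (k + 1) = B at *
    have hweight := one_sub_inv_mul_mul_one_sub_inv_mul hB (add_comm A B ▸ hS)
    rw [add_comm B A] at hweight
    rw [one_sub_inv_mul_mul_one_sub_inv_mul hA hS, hweight, Matrix.mul_assoc, Matrix.mul_assoc,
      Matrix.mul_assoc B⁻¹, mul_nonsing_inv_cancel_left _ _ ((isUnit_iff_isUnit_det A).1 hA),
      mul_nonsing_inv_cancel_left _ _ ((isUnit_iff_isUnit_det B).1 hB), Matrix.mul_add]
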